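/- Let $K$ be a field, let $g \geq 2$ be an integer, and let $a_1, \dots, a_g \in K$ with $a_1 \neq 0$. Set $y = a_1 x + a_2 x^2 + \cdots + a_g x^g \in K[x]$. Then there exists a unique tuple $(k_1, \dots, k_g) \in K^g$ such that the polynomial $\kappa = 1 + k_1 x + \cdots + k_g x^g$ satisfies: for every integer $n$ with $0 \leq n \leq g-1$, the coefficient of $x^g$ in $\kappa \cdot y^n$ is zero. Moreover, for this unique tuple one has $k_g = 0$. -/

import Mathlib

open Polynomial

/-- The matrix of the coefficients of `1, y, …, y ^ (g - 1)` is invertible when `y` has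
vanishing constant term and nonvanishing linear term. -/
theorem isUnit_matrix_coeff_pow {K : Type*} [Field K] (g : ℕ) (y : K[X])
    (h0 : y.coeff 0 = 0) (h1 : y.coeff 1 ≠ 0) :
    IsUnit (Matrix.of fun n j : Fin g => (y ^ (n : ℕ)).coeff (j : ℕ)) := by
  obtain ⟨q, rfl⟩ := X_dvd_iff.mpr h0
  have hq : q.coeff 0 ≠ 0 := by simpa using h1
  rw [Matrix.isUnit_iff_isUnit_det, isUnit_iff_ne_zero, Matrix.det_of_isUpperTriangular]
  · refine Finset.prod_ne_zero_iff.mpr fun i _ => ?_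
    rw [Matrix.of_apply, mul_pow, coeff_X_pow_mul', if_pos le_rfl, Nat.sub_self,
      coeff_zero_eq_eval_zero, eval_pow, ← coeff_zero_eq_eval_zero]
    exact pow_ne_zero _ hq
  · intro n j hjn
    have hlt : (j : ℕ) < n := hjn
    rw [Matrix.of_apply, mul_pow, coeff_X_pow_mul', if_neg hlt.not_ge]

/-- The top coefficient of `(1 + k₁x + ⋯ + k_g x^g) * p` as a linear expression in `k`. -/
theorem coeff_one_add_sum_mul {K : Type*} [Field K] (g : ℕ) (k : Fin g → K) (p : K[X]) :
    (((1 : K[X]) + ∑ i : Fin g, C (k i) * X ^ (i.1 + 1)) * p).coeff g =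
      p.coeff g + ∑ j : Fin g, p.coeff (j : ℕ) * k j.rev := by
  rw [add_mul, one_mul, coeff_add, Finset.sum_mul, finsetSum_coeff,
    ← Equiv.sum_comp Fin.revPerm]
  congr 1
  refine Finset.sum_congr rfl fun j _ => ?_
  have hj := j.isLt
  have hle : g - (j + 1) + 1 ≤ g := by omega
  have hsub : g - (g - ((j : ℕ) + 1) + 1) = j := by omega
  rw [mul_assoc, coeff_C_mul, coeff_X_pow_mul', Fin.revPerm_apply, Fin.val_rev, if_pos hle,
    hsub, mul_comm]

/-- For a crimping datum `y = a₁x + ⋯ + a_g x^g` with `a₁ ≠ 0`, there is a unique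
tuple `(k₁, …, k_g)` such that `κ = 1 + k₁x + ⋯ + k_g x^g` has the property that the
coefficient of `x^g` in `κ · yⁿ` vanishes for all `0 ≤ n ≤ g-1`; moreover for this
tuple `k_g = 0`. -/
theorem dualizing_gluing_datum_exists_unique
    (K : Type*) [Field K] (g : ℕ) (hg : 2 ≤ g) (a : ℕ → K) (ha : a 1 ≠ 0) :
    (∃! k : Fin g → K,
      ∀ n : ℕ, n ≤ g - 1 →
        (((1 : K[X]) + ∑ i : Fin g, C (k i) * X ^ (i.1 + 1)) *
            (∑ i ∈ Finset.Icc 1 g, C (a i) * X ^ i) ^ n).coeff g = 0) ∧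
    (∀ k : Fin g → K,
      (∀ n : ℕ, n ≤ g - 1 →
        (((1 : K[X]) + ∑ i : Fin g, C (k i) * X ^ (i.1 + 1)) *
            (∑ i ∈ Finset.Icc 1 g, C (a i) * X ^ i) ^ n).coeff g = 0) →
      k ⟨g - 1, by omega⟩ = 0) := by
  set y : K[X] := ∑ i ∈ Finset.Icc 1 g, C (a i) * X ^ i with hy
  have h0 : y.coeff 0 = 0 := by simp [hy, coeff_X_pow]
  have h1 : y.coeff 1 ≠ 0 := by
    have hg1 : 1 ≤ g := by omega
    simpa [hy, coeff_X_pow, hg1] using ha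
  have hU := isUnit_matrix_coeff_pow g y h0 h1
  set U : Matrix (Fin g) (Fin g) K := Matrix.of fun n j => (y ^ (n : ℕ)).coeff (j : ℕ) with hUdef
  have key (k : Fin g → K) : (∀ n : ℕ, n ≤ g - 1 →
      (((1 : K[X]) + ∑ i : Fin g, C (k i) * X ^ (i.1 + 1)) * y ^ n).coeff g = 0) ↔
      U.mulVec (k ∘ Fin.rev) = fun n : Fin g => -(y ^ (n : ℕ)).coeff g := by
    simp only [coeff_one_add_sum_mul, funext_iff, Matrix.mulVec, dotProduct, hUdef,
      Matrix.of_apply, Function.comp_apply, eq_neg_iff_add_eq_zero]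
    constructor
    · intro h n
      rw [add_comm]
      exact h n (by omega)
    · intro h n hn
      rw [add_comm]
      exact h ⟨n, by omega⟩
  refine ⟨?_, fun k hk => ?_⟩
  · simp only [key]
    obtain ⟨v, hv⟩ := Matrix.mulVec_surjective_iff_isUnit.mpr hU fun n : Fin g => -(y ^ (n : ℕ)).coeff g
    refine ⟨v ∘ Fin.rev, ?_, fun k hk => ?_⟩
    · simpa [Function.comp_assoc, Fin.rev_involutive.comp_self] using hv
    · have hkv := Matrix.mulVec_injective_iff_isUnit.mpr hU (hk.trans hv.symm)
      simp [← hkv, Function.comp_assoc, Fin.rev_involutive.comp_self]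
  · have hk0 := hk 0 (Nat.zero_le _)
    have hlast (i : Fin g) : (g = i.1 + 1) ↔ i = ⟨g - 1, by omega⟩ := by
      rw [Fin.ext_iff]
      simp only
      omega
    have hg0 : g ≠ 0 := by omega
    simpa [coeff_one, coeff_X_pow, hg0, hlast] using hk0
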